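/- Let μ be a probability measure on a complete separable metric space (X,d), let α be a Young function, and let c > 0. Then the following are equivalent: (i) μ satisfies the transport-entropy inequality T_α(1/c); (ii) there exist constants a, b > 0 such that for every n ∈ ℕ* and every bounded continuous function f : X^n → [0,∞), ∫ e^{c Q_{α,n} f} dμ^n ≤ a · e^{b ∫ f dμ^n}, where Q_{α,n} f(x) = inf_{y∈X^n} { f(y) + Σ_{i=1}^n α(d(x_i,y_i)) }. -/

import Mathlib

open MeasureTheory Filter Set Topology
open scoped ENNReal NNReal

noncomputable section

/-- The right derivative of a function `α : ℝ → ℝ`. -/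
def rightD (α : ℝ → ℝ) (x : ℝ) : ℝ := derivWithin α (Set.Ioi x) x

/-- The left derivative of a function `α : ℝ → ℝ`. -/
def leftD (α : ℝ → ℝ) (x : ℝ) : ℝ := derivWithin α (Set.Iio x) x

/-- A Young function: an even, convex, nonnegative function, increasing on `[0,∞)`,
vanishing at `0` and with vanishing right derivative at `0`. -/
structure IsYoung (α : ℝ → ℝ) : Prop where
  nonneg : ∀ x, 0 ≤ α x
  even : ∀ x, α (-x) = α x
  convex : ConvexOn ℝ Set.univ α
  mono : StrictMonoOn α (Set.Ici 0)
  zero : α 0 = 0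
  rightD_zero : rightD α 0 = 0

/-- The Δ₂-condition for a Young function. -/
def DeltaTwo (α : ℝ → ℝ) : Prop := ∃ K > 0, ∀ x : ℝ, α (2 * x) ≤ K * α x

/-- `r_α = inf_{x>0} x α'₋(x)/α(x)`. -/
def rAlpha (α : ℝ → ℝ) : ℝ := sInf {r : ℝ | ∃ x > 0, r = x * leftD α x / α x}

/-- `p_α = sup_{x>0} x α'₊(x)/α(x)`. -/
def pAlpha (α : ℝ → ℝ) : ℝ := sSup {r : ℝ | ∃ x > 0, r = x * rightD α x / α x}

/-- The Fenchel-Legendre transform `α*(y) = sup_x {xy - α(x)}`, with values in `[0,∞]`. -/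
def legendre (α : ℝ → ℝ) (y : ℝ) : ℝ≥0∞ := ⨆ x : ℝ, ENNReal.ofReal (x * y - α x)

/-- `ξ_α(t) = sup_{u>0} α*(t α'₊(u)) / (t α(u))`. -/
def xiAlpha (α : ℝ → ℝ) (t : ℝ) : ℝ≥0∞ :=
  ⨆ u : {u : ℝ // 0 < u}, legendre α (t * rightD α u) / ENNReal.ofReal (t * α u)

/-- A bounded real-valued function. -/
def IsBoundedFun {Y : Type*} (f : Y → ℝ) : Prop := ∃ M, ∀ x, |f x| ≤ M

variable {X : Type*} [MetricSpace X] [MeasurableSpace X]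

/-- The optimal transport cost `T_α(ν,μ)` between two measures, for the cost
function `(x,y) ↦ α(d(x,y))`. -/
def transportCost (α : ℝ → ℝ) (ν μ : Measure X) : ℝ≥0∞ :=
  sInf { c : ℝ≥0∞ | ∃ π : Measure (X × X), π.map Prod.fst = ν ∧ π.map Prod.snd = μ ∧
      c = ∫⁻ z, ENNReal.ofReal (α (dist z.1 z.2)) ∂π }

open Classical in
/-- The relative entropy `H(ν|μ) = ∫ log (dν/dμ) dν` if `ν ≪ μ` (and `+∞` if `ν` is not
absolutely continuous with respect to `μ`, or if the integral diverges). -/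
def relEnt (ν μ : Measure X) : ℝ≥0∞ :=
  if ν ≪ μ ∧ Integrable (fun x => Real.log (ν.rnDeriv μ x).toReal) ν
  then ENNReal.ofReal (∫ x, Real.log (ν.rnDeriv μ x).toReal ∂ν) else ⊤

/-- The transport-entropy inequality `T_α(C)`: for every probability measure `ν`,
`T_α(ν,μ) ≤ C H(ν|μ)`. -/
def TransportEntropy (μ : Measure X) (α : ℝ → ℝ) (C : ℝ) : Prop :=
  ∀ ν : Measure X, IsProbabilityMeasure ν →
    transportCost α ν μ ≤ ENNReal.ofReal C * relEnt ν μ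

/-- The entropy functional `Ent_μ(e^f)`. -/
def entExp (μ : Measure X) (f : X → ℝ) : ℝ :=
  ∫ x, Real.exp (f x) * Real.log (Real.exp (f x)) ∂μ
    - (∫ x, Real.exp (f x) ∂μ) * Real.log (∫ x, Real.exp (f x) ∂μ)

/-- `|∇⁺ f|(x) = limsup_{y → x} [f(y) - f(x)]₊ / d(y,x)` (equal to `0` at isolated
points by the conventions on `limsup` and `sInf` in `ℝ`). -/
def gradPlus (f : X → ℝ) (x : X) : ℝ :=
  limsup (fun y => max (f y - f x) 0 / dist y x) (𝓝[≠] x)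

/-- `|∇⁻ f|(x) = limsup_{y → x} [f(y) - f(x)]₋ / d(y,x)` (equal to `0` at isolated
points by the conventions on `limsup` and `sInf` in `ℝ`). -/
def gradMinus (f : X → ℝ) (x : X) : ℝ :=
  limsup (fun y => max (-(f y - f x)) 0 / dist y x) (𝓝[≠] x)

/-- The modified log-Sobolev inequality plus `LSI⁺_α(A)`. -/
def LSIplus (μ : Measure X) (α : ℝ → ℝ) (A : ℝ) : Prop :=
  ∀ f : X → ℝ, IsBoundedFun f → LocallyLipschitz f →
    ENNReal.ofReal (entExp μ f) ≤
      ENNReal.ofReal A * ∫⁻ x, legendre α (gradPlus f x) * ENNReal.ofReal (Real.exp (f x)) ∂μ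

/-- The modified log-Sobolev inequality minus `LSI⁻_α(A)`. -/
def LSIminus (μ : Measure X) (α : ℝ → ℝ) (A : ℝ) : Prop :=
  ∀ f : X → ℝ, IsBoundedFun f → LocallyLipschitz f →
    ENNReal.ofReal (entExp μ f) ≤
      ENNReal.ofReal A * ∫⁻ x, legendre α (gradMinus f x) * ENNReal.ofReal (Real.exp (f x)) ∂μ

/-- The inf-convolution operator `Q_α^λ f(x) = inf_y {f(y) + λ α(d(x,y))}`. -/
def QInf (α : ℝ → ℝ) (lam : ℝ) (f : X → ℝ) (x : X) : ℝ :=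
  ⨅ y : X, (f y + lam * α (dist x y))

/-- The `(τ)`-log-Sobolev inequality `(τ)-LSI_α(λ, A)`. -/
def TauLSI (μ : Measure X) (α : ℝ → ℝ) (lam A : ℝ) : Prop :=
  ∀ f : X → ℝ, IsBoundedFun f → LocallyLipschitz f →
    entExp μ f ≤ A * ∫ x, (f x - QInf α lam f x) * Real.exp (f x) ∂μ

/-- The `n`-dimensional inf-convolution operator
`Q_{α,n} f(x) = inf_y {f(y) + Σᵢ α(d(xᵢ,yᵢ))}`. -/
def QInfN (α : ℝ → ℝ) {n : ℕ} (f : (Fin n → X) → ℝ) (x : Fin n → X) : ℝ :=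
  ⨅ y : Fin n → X, (f y + ∑ i, α (dist (x i) (y i)))

/-- The `n`-dimensional sup-convolution operator
`P_{α,n} f(x) = sup_y {f(y) - Σᵢ α(d(xᵢ,yᵢ))}`. -/
def PSupN (α : ℝ → ℝ) {n : ℕ} (f : (Fin n → X) → ℝ) (x : Fin n → X) : ℝ :=
  ⨆ y : Fin n → X, (f y - ∑ i, α (dist (x i) (y i)))

end

/-- The inf-convolution of `f` with the cost `k`. -/
noncomputable def infConv {Y : Type*} (k : Y → Y → ℝ) (f : Y → ℝ) (x : Y) : ℝ :=
  ⨅ y, (f y + k x y)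

section infConv

variable {Y : Type*} {k : Y → Y → ℝ} {f : Y → ℝ}

lemma bddBelow_range_infConv (hk : ∀ x y, 0 ≤ k x y) (hf : IsBoundedFun f) (x : Y) :
    BddBelow (range fun y => f y + k x y) := by
  obtain ⟨M, hM⟩ := hf
  refine ⟨-M, ?_⟩
  rintro _ ⟨y, rfl⟩
  have := neg_le_of_abs_le (hM y)
  have := hk x y
  simp only
  linarith

lemma infConv_le (hk : ∀ x y, 0 ≤ k x y) (hf : IsBoundedFun f) (x y : Y) :
    infConv k f x ≤ f y + k x y :=
  ciInf_le (bddBelow_range_infConv hk hf x) y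

lemma isBoundedFun_infConv [Nonempty Y] (hk : ∀ x y, 0 ≤ k x y) (hk0 : ∀ x, k x x = 0)
    (hf : IsBoundedFun f) : IsBoundedFun (infConv k f) := by
  obtain ⟨M, hM⟩ := hf
  refine ⟨M, fun x => abs_le.2 ⟨le_ciInf fun y => ?_, ?_⟩⟩
  · have := neg_le_of_abs_le (hM y)
    have := hk x y
    linarith
  · have := infConv_le hk ⟨M, hM⟩ x x
    rw [hk0, add_zero] at this
    exact this.trans (le_of_abs_le (hM x))

lemma upperSemicontinuous_infConv [TopologicalSpace Y] (hk : ∀ x y, 0 ≤ k x y)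
    (hkc : ∀ y, Continuous fun x => k x y) (hf : IsBoundedFun f) :
    UpperSemicontinuous (infConv k f) :=
  upperSemicontinuous_ciInf (bddBelow_range_infConv hk hf)
    fun y => (continuous_const.add (hkc y)).upperSemicontinuous

end infConv

lemma IsYoung.continuous {α : ℝ → ℝ} (hα : IsYoung α) : Continuous α :=
  continuousOn_univ.1 (hα.convex.continuousOn isOpen_univ)

lemma IsBoundedFun.integrable {Y : Type*} [MeasurableSpace Y] {f : Y → ℝ} (hf : IsBoundedFun f)
    (hfm : Measurable f) (μ : Measure Y) [IsFiniteMeasure μ] : Integrable f μ := by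
  obtain ⟨M, hM⟩ := hf
  exact Integrable.of_bound hfm.aestronglyMeasurable M (ae_of_all _ hM)

lemma IsBoundedFun.const_mul {Y : Type*} {f : Y → ℝ} (hf : IsBoundedFun f) (c : ℝ) :
    IsBoundedFun fun x => c * f x := by
  obtain ⟨M, hM⟩ := hf
  exact ⟨|c| * M, fun x => by rw [abs_mul]; gcongr; exact hM x⟩

lemma IsBoundedFun.exp {Y : Type*} {f : Y → ℝ} (hf : IsBoundedFun f) :
    IsBoundedFun fun x => Real.exp (f x) := by
  obtain ⟨M, hM⟩ := hf
  exact ⟨Real.exp M, fun x => by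
    rw [Real.abs_exp]; exact Real.exp_le_exp.2 (le_of_abs_le (hM x))⟩

lemma isProbabilityMeasure_of_map_fst {X Y : Type*} [MeasurableSpace X] [MeasurableSpace Y]
    {π : Measure (X × Y)} {ν : Measure X} [IsProbabilityMeasure ν] (h : π.map Prod.fst = ν) :
    IsProbabilityMeasure π :=
  ⟨by rw [← preimage_univ (f := Prod.fst), ← Measure.map_apply measurable_fst .univ, h,
    measure_univ]⟩

/-- The Donsker–Varadhan inequality for bounded test functions. -/
lemma integral_le_integral_llr_add_log {Y : Type*} [MeasurableSpace Y] {μ ν : Measure Y}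
    [IsProbabilityMeasure μ] [IsProbabilityMeasure ν] {g : Y → ℝ} (hg : IsBoundedFun g)
    (hgm : Measurable g) (hνμ : ν ≪ μ) (hInt : Integrable (llr ν μ) ν) :
    ∫ x, g x ∂ν ≤ ∫ x, llr ν μ x ∂ν + Real.log (∫ x, Real.exp (g x) ∂μ) := by
  have hexp := hg.exp.integrable hgm.exp μ
  have : IsProbabilityMeasure (μ.tilted g) := isProbabilityMeasure_tilted hexp
  have h1 := InformationTheory.integral_llr_add_sub_measure_univ_nonneg
    (hνμ.trans (absolutelyContinuous_tilted hexp))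
    (integrable_llr_tilted_right hνμ (hg.integrable hgm ν) hInt hexp)
  rw [integral_llr_tilted_right hνμ (hg.integrable hgm ν) hexp hInt] at h1
  simp only [probReal_univ] at h1
  linarith

section Duality

variable {X : Type*} [MetricSpace X] [MeasurableSpace X] [BorelSpace X] {α : ℝ → ℝ}

/-- The easy half of Kantorovich duality. -/
lemma ofReal_integral_infConv_sub_le_transportCost (hα : IsYoung α) {ν μ : Measure X}
    [IsProbabilityMeasure ν] [IsProbabilityMeasure μ] {h : X → ℝ} (hh : IsBoundedFun h)
    (hm : Measurable h) :
    ENNReal.ofReal (∫ x, infConv (fun x y => α (dist x y)) h x ∂ν - ∫ x, h x ∂μ) ≤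
      transportCost α ν μ := by
  have hk : ∀ x y : X, 0 ≤ α (dist x y) := fun x y => hα.nonneg _
  have hk0 : ∀ x : X, α (dist x x) = 0 := fun x => by simp [hα.zero]
  have hkc : ∀ y : X, Continuous fun x => α (dist x y) := fun y =>
    hα.continuous.comp (continuous_id.dist continuous_const)
  set Q := infConv (fun x y : X => α (dist x y)) h with hQ
  have : Nonempty X := nonempty_of_isProbabilityMeasure μ
  have hQb : IsBoundedFun Q := isBoundedFun_infConv hk hk0 hh
  have hQm : Measurable Q := (upperSemicontinuous_infConv hk hkc hh).measurable
  refine le_sInf ?_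
  rintro _ ⟨π, h1, h2, rfl⟩
  have : IsProbabilityMeasure π := isProbabilityMeasure_of_map_fst h1
  have hQi : Integrable (fun z : X × X => Q z.1) π := by
    obtain ⟨M, hM⟩ := hQb
    exact Integrable.of_bound (hQm.comp measurable_fst).aestronglyMeasurable M
      (ae_of_all _ fun z => hM z.1)
  have hhi : Integrable (fun z : X × X => h z.2) π := by
    obtain ⟨M, hM⟩ := hh
    exact Integrable.of_bound (hm.comp measurable_snd).aestronglyMeasurable M
      (ae_of_all _ fun z => hM z.2)
  rw [← h1, ← h2, integral_map measurable_fst.aemeasurable hQm.aestronglyMeasurable,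
    integral_map measurable_snd.aemeasurable hm.aestronglyMeasurable, ← integral_sub hQi hhi,
    integral_eq_lintegral_pos_part_sub_lintegral_neg_part
      (f := fun z : X × X => Q z.1 - h z.2) (hQi.sub hhi)]
  refine (ENNReal.ofReal_le_ofReal (sub_le_self _ ENNReal.toReal_nonneg)).trans ?_
  refine ENNReal.ofReal_toReal_le.trans (lintegral_mono fun z => ENNReal.ofReal_le_ofReal ?_)
  have := infConv_le hk hh z.1 z.2
  linarith

/-- Testing the transport-entropy inequality on exponential tilts. -/
lemma TransportEntropy.integral_exp_infConv_le (hα : IsYoung α) {μ : Measure X}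
    [IsProbabilityMeasure μ] {c : ℝ} (hc : 0 < c) (hT : TransportEntropy μ α (1 / c))
    {h : X → ℝ} (hh : IsBoundedFun h) (hm : Measurable h) :
    ∫ x, Real.exp (c * infConv (fun x y => α (dist x y)) h x) ∂μ ≤
      Real.exp (c * ∫ x, h x ∂μ) := by
  have hk : ∀ x y : X, 0 ≤ α (dist x y) := fun x y => hα.nonneg _
  have hk0 : ∀ x : X, α (dist x x) = 0 := fun x => by simp [hα.zero]
  have hkc : ∀ y : X, Continuous fun x => α (dist x y) := fun y =>
    hα.continuous.comp (continuous_id.dist continuous_const)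
  have hle := fun (ν : Measure X) (hν : IsProbabilityMeasure ν) =>
    (ofReal_integral_infConv_sub_le_transportCost hα (ν := ν) (μ := μ) hh hm).trans (hT ν hν)
  set Q := infConv (fun x y : X => α (dist x y)) h with hQ
  have : Nonempty X := nonempty_of_isProbabilityMeasure μ
  have hQb : IsBoundedFun Q := isBoundedFun_infConv hk hk0 hh
  have hQm : Measurable Q := (upperSemicontinuous_infConv hk hkc hh).measurable
  set g : X → ℝ := fun x => c * Q x with hg
  have hgm : Measurable g := hQm.const_mul c
  have hexp : Integrable (fun x => Real.exp (g x)) μ :=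
    (hQb.const_mul c).exp.integrable hgm.exp μ
  have hprob : IsProbabilityMeasure (μ.tilted g) := isProbabilityMeasure_tilted hexp
  have hZ : 0 < ∫ x, Real.exp (g x) ∂μ := integral_exp_pos hexp
  have hllr : (fun x => Real.log ((μ.tilted g).rnDeriv μ x).toReal) =ᵐ[μ.tilted g]
      fun x => g x - Real.log (∫ x, Real.exp (g x) ∂μ) :=
    (tilted_absolutelyContinuous μ g).ae_le (log_rnDeriv_tilted_left_self hexp)
  have hgi : Integrable g (μ.tilted g) := (hQb.const_mul c).integrable hgm _
  have hInt : Integrable (fun x => Real.log ((μ.tilted g).rnDeriv μ x).toReal) (μ.tilted g) :=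
    (hgi.sub (integrable_const _)).congr hllr.symm
  have hH : relEnt (μ.tilted g) μ = ENNReal.ofReal
      (c * ∫ x, Q x ∂(μ.tilted g) - Real.log (∫ x, Real.exp (g x) ∂μ)) := by
    rw [relEnt, if_pos ⟨tilted_absolutelyContinuous μ g, hInt⟩, integral_congr_ae hllr,
      integral_sub hgi (integrable_const _), integral_const_mul]
    simp
  have hmain := hle (μ.tilted g) hprob
  rw [hH, ← ENNReal.ofReal_mul (by positivity)] at hmain
  have hnn : 0 ≤ c * ∫ x, Q x ∂(μ.tilted g) - Real.log (∫ x, Real.exp (g x) ∂μ) := by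
    have h0 := InformationTheory.integral_llr_add_sub_measure_univ_nonneg
      (tilted_absolutelyContinuous μ g) hInt
    rw [llr_def, integral_congr_ae hllr, integral_sub hgi (integrable_const _),
      integral_const_mul] at h0
    simpa using h0
  rw [ENNReal.ofReal_le_ofReal_iff (by positivity), one_div, inv_mul_eq_div,
    le_div_iff₀ hc] at hmain
  rw [← Real.log_le_iff_le_exp hZ]
  linarith

end Duality

section Tensorization

variable {X : Type*} [MetricSpace X] {α : ℝ → ℝ}

lemma IsYoung.sum_nonneg (hα : IsYoung α) {n : ℕ} (x y : Fin n → X) :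
    0 ≤ ∑ i, α (dist (x i) (y i)) :=
  Finset.sum_nonneg fun _ _ => hα.nonneg _

lemma QInfN_le (hα : IsYoung α) {n : ℕ} {f : (Fin n → X) → ℝ} (hf : IsBoundedFun f)
    (x y : Fin n → X) : QInfN α f x ≤ f y + ∑ i, α (dist (x i) (y i)) :=
  infConv_le hα.sum_nonneg hf x y

lemma isBoundedFun_QInfN [Nonempty X] (hα : IsYoung α) {n : ℕ} {f : (Fin n → X) → ℝ}
    (hf : IsBoundedFun f) : IsBoundedFun (QInfN α f) :=
  isBoundedFun_infConv hα.sum_nonneg (fun x => by simp [hα.zero]) hf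

lemma IsBoundedFun.of_comp {Y Z : Type*} {f : Y → ℝ} (hf : IsBoundedFun f) (g : Z → Y) :
    IsBoundedFun fun z => f (g z) := by
  obtain ⟨M, hM⟩ := hf
  exact ⟨M, fun z => hM (g z)⟩

lemma abs_integral_le_of_abs_le {Y : Type*} [MeasurableSpace Y] (μ : Measure Y)
    [IsProbabilityMeasure μ] {f : Y → ℝ} {M : ℝ} (hM : ∀ x, |f x| ≤ M) : |∫ x, f x ∂μ| ≤ M := by
  simpa using norm_integral_le_of_norm_le_const (f := f) (C := M) (ae_of_all μ hM)

lemma integral_pi_succ {X : Type*} [MeasurableSpace X] (μ : Measure X) [IsProbabilityMeasure μ]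
    {n : ℕ} {F : (Fin (n + 1) → X) → ℝ} (hF : IsBoundedFun F) (hFm : Measurable F) :
    ∫ x, F x ∂(Measure.pi fun _ : Fin (n + 1) => μ) =
      ∫ z, ∫ a, F (Fin.cons a z) ∂μ ∂(Measure.pi fun _ : Fin n => μ) := by
  have hmp := (measurePreserving_piFinSuccAbove (fun _ : Fin (n + 1) => μ) 0).symm
  rw [← hmp.integral_comp', integral_prod_symm]
  · simp [MeasurableEquiv.piFinSuccAbove, Fin.insertNthEquiv]
  · exact (hF.of_comp _).integrable (hFm.comp (MeasurableEquiv.measurable _)) _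

variable [TopologicalSpace.SeparableSpace X] [MeasurableSpace X] [BorelSpace X]

lemma measurable_QInfN (hα : IsYoung α) {n : ℕ} {f : (Fin n → X) → ℝ}
    (hf : IsBoundedFun f) : Measurable (QInfN α f) := by
  have := UniformSpace.secondCountable_of_separable X
  exact (upperSemicontinuous_infConv hα.sum_nonneg (fun y => continuous_finsetSum _ fun i _ =>
    hα.continuous.comp ((continuous_apply i).dist continuous_const)) hf).measurable

/-- Tensorization of the dual form of the transport-entropy inequality. -/
lemma integral_exp_QInfN_le (hα : IsYoung α) {μ : Measure X} [IsProbabilityMeasure μ] {c : ℝ}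
    (hc : 0 < c)
    (hD : ∀ h : X → ℝ, IsBoundedFun h → Measurable h →
      ∫ x, Real.exp (c * infConv (fun x y => α (dist x y)) h x) ∂μ ≤
        Real.exp (c * ∫ x, h x ∂μ)) (n : ℕ) :
    ∀ f : (Fin n → X) → ℝ, Continuous f → IsBoundedFun f →
      ∫ x, Real.exp (c * QInfN α f x) ∂(Measure.pi fun _ : Fin n => μ) ≤
        Real.exp (c * ∫ x, f x ∂(Measure.pi fun _ : Fin n => μ)) := by
  have := UniformSpace.secondCountable_of_separable X
  have : Nonempty X := nonempty_of_isProbabilityMeasure μ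
  have hk : ∀ x y : X, 0 ≤ α (dist x y) := fun x y => hα.nonneg _
  have hk0 : ∀ x : X, α (dist x x) = 0 := fun x => by simp [hα.zero]
  have hkc : ∀ y : X, Continuous fun x => α (dist x y) := fun y =>
    hα.continuous.comp (continuous_id.dist continuous_const)
  induction n with
  | zero =>
    intro f _ _
    simp [QInfN, ciInf_unique, Subsingleton.elim _ (default : Fin 0 → X)]
  | succ n ih =>
    intro f hfc hfb
    obtain ⟨M, hM⟩ := id hfb
    have hcons : Continuous fun p : X × (Fin n → X) => (Fin.cons p.1 p.2 : Fin (n + 1) → X) :=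
      Continuous.finCons (A := fun _ => X) continuous_fst continuous_snd
    have hcons₁ : ∀ z : Fin n → X, Continuous fun a : X => (Fin.cons a z : Fin (n + 1) → X) :=
      fun z => hcons.comp (continuous_id.prodMk continuous_const)
    have hcons₂ : ∀ a : X, Continuous fun z : Fin n → X => (Fin.cons a z : Fin (n + 1) → X) :=
      fun a => hcons.comp (continuous_const.prodMk continuous_id)
    set F : (Fin n → X) → ℝ := fun z => ∫ a, f (Fin.cons a z) ∂μ with hF
    have hFc : Continuous F :=
      continuous_of_dominated (fun z => (hfc.comp (hcons₁ z)).aestronglyMeasurable)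
        (fun z => ae_of_all _ fun a => hM _) (integrable_const M)
        (ae_of_all _ fun a => hfc.comp (hcons₂ a))
    have hFb : IsBoundedFun F := ⟨M, fun z => abs_integral_le_of_abs_le μ fun a => hM _⟩
    set Q := QInfN α f with hQ
    have hQb : IsBoundedFun Q := isBoundedFun_QInfN hα hfb
    have hQm : Measurable Q := measurable_QInfN hα hfb
    rw [integral_pi_succ μ (hQb.const_mul c).exp (hQm.const_mul c).exp,
      integral_pi_succ μ hfb hfc.measurable]
    refine le_trans ?_ (ih F hFc hFb)
    refine integral_mono_of_nonneg (ae_of_all _ fun z => by positivity)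
      (((isBoundedFun_QInfN hα hFb).const_mul c).exp.integrable
        ((measurable_QInfN hα hFb).const_mul c).exp _) (ae_of_all _ fun z => ?_)
    set g : X → ℝ := fun a => QInfN α (fun y => f (Fin.cons a y)) z with hg
    have hgb : IsBoundedFun g := by
      refine ⟨M, fun a => ?_⟩
      refine abs_le.2 ⟨le_ciInf fun y => ?_, ?_⟩
      · have := neg_le_of_abs_le (hM (Fin.cons a y))
        have := hα.sum_nonneg z y
        linarith
      · have := QInfN_le hα (hfb.of_comp fun y : Fin n → X => (Fin.cons a y : Fin (n + 1) → X)) z z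
        simp only [dist_self, hα.zero, Finset.sum_const_zero, add_zero] at this
        exact this.trans (le_of_abs_le (hM _))
    have hgm : Measurable g :=
      (upperSemicontinuous_ciInf (fun a => bddBelow_range_infConv hα.sum_nonneg
        (hfb.of_comp fun y : Fin n → X => (Fin.cons a y : Fin (n + 1) → X)) z)
        fun y => ((hfc.comp (hcons₁ y)).add continuous_const).upperSemicontinuous).measurable
    have hQg : ∀ a, Q (Fin.cons a z) ≤ infConv (fun x y => α (dist x y)) g a := by
      refine fun a => le_ciInf fun b => ?_
      rw [← sub_le_iff_le_add]
      refine le_ciInf fun y => ?_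
      have := QInfN_le hα hfb (Fin.cons a z) (Fin.cons b y)
      rw [Fin.sum_univ_succ] at this
      simp only [Fin.cons_zero, Fin.cons_succ] at this
      linarith
    have hgF : ∫ a, g a ∂μ ≤ QInfN α F z := by
      refine le_ciInf fun y => ?_
      have hi : Integrable (fun a => f (Fin.cons a y)) μ :=
        (hfb.of_comp _).integrable (hfc.comp (hcons₁ y)).measurable μ
      have : F y + ∑ i, α (dist (z i) (y i)) =
          ∫ a, (f (Fin.cons a y) + ∑ i, α (dist (z i) (y i))) ∂μ := by
        rw [integral_add hi (integrable_const _)]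
        simp [hF]
      rw [this]
      exact integral_mono (hgb.integrable hgm μ) (hi.add (integrable_const _)) fun a =>
        QInfN_le hα (hfb.of_comp fun y : Fin n → X => (Fin.cons a y : Fin (n + 1) → X)) z y
    calc ∫ a, Real.exp (c * Q (Fin.cons a z)) ∂μ
        ≤ ∫ a, Real.exp (c * infConv (fun x y => α (dist x y)) g a) ∂μ := by
          refine integral_mono_of_nonneg (ae_of_all _ fun a => by positivity)
            (((isBoundedFun_infConv hk hk0 hgb).const_mul c).exp.integrable
              ((upperSemicontinuous_infConv hk hkc hgb).measurable.const_mul c).exp _)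
            (ae_of_all _ fun a => ?_)
          simp only
          gcongr
          exact hQg a
      _ ≤ Real.exp (c * ∫ a, g a ∂μ) := hD g hgb hgm
      _ ≤ Real.exp (c * QInfN α F z) := by gcongr

end Tensorization

section Tightening

lemma le_one_of_pow_le_mul_exp_sqrt {A a s : ℝ}
    (h : ∀ n : ℕ, 0 < n → A ^ n ≤ a * Real.exp (s * √n)) : A ≤ 1 := by
  by_contra! hA
  obtain ⟨m, hm, hm0, hma⟩ := ((tendsto_pow_atTop_atTop_of_one_lt hA).eventually_ge_atTop
    (2 * Real.exp s)).and ((eventually_gt_atTop 0).and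
      ((tendsto_pow_atTop_atTop_of_one_lt one_lt_two).eventually_gt_atTop a)) |>.exists
  have h1 := h (m * m) (by positivity)
  rw [Nat.cast_mul, Real.sqrt_mul_self (by positivity), pow_mul, mul_comm s, Real.exp_nat_mul] at h1
  have h2 : (2 * Real.exp s) ^ m ≤ (A ^ m) ^ m := by gcongr
  rw [mul_pow] at h2
  have h3 : 2 ^ m ≤ a := le_of_mul_le_mul_right (h2.trans h1) (by positivity)
  linarith

/-- Fluctuations of centered sums in product spaces are of order `√n`. -/
lemma integral_posPart_sum_le {X : Type*} [MeasurableSpace X] (μ : Measure X)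
    [IsProbabilityMeasure μ] {h : X → ℝ} {M : ℝ} (hM : ∀ x, |h x| ≤ M) (hm : Measurable h)
    (h0 : ∫ x, h x ∂μ = 0) (n : ℕ) :
    ∫ x, max (∑ i, h (x i)) 0 ∂(Measure.pi fun _ : Fin n => μ) ≤ M * √n := by
  obtain ⟨x₀⟩ := nonempty_of_isProbabilityMeasure μ
  have hM0 : 0 ≤ M := (abs_nonneg _).trans (hM x₀)
  set P := Measure.pi fun _ : Fin n => μ with hP
  set S : (Fin n → X) → ℝ := ∑ i, fun x => h (x i) with hS
  have hmem : MemLp h 2 μ := MemLp.of_bound hm.aestronglyMeasurable M (ae_of_all _ hM)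
  have hmem' : ∀ i : Fin n, MemLp (fun x : Fin n → X => h (x i)) 2 P := fun i =>
    hmem.comp_measurePreserving (measurePreserving_eval _ i)
  have hSmem : MemLp S 2 P := memLp_finsetSum' _ fun i _ => hmem' i
  have hS0 : ∫ x, S x ∂P = 0 := by
    simp only [hS, Finset.sum_apply]
    rw [integral_finsetSum _ fun i _ => (hmem' i).integrable one_le_two]
    refine Finset.sum_eq_zero fun i _ => ?_
    rw [integral_comp_eval (μ := fun _ : Fin n => μ) (i := i) hm.aestronglyMeasurable, h0]
  have hvar : ∫ x, S x ^ 2 ∂P ≤ n * M ^ 2 := by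
    have h1 := ProbabilityTheory.variance_sum_pi (μ := fun _ : Fin n => μ) (X := fun _ => h)
      fun _ => hmem
    rw [← hS, ← hP, ProbabilityTheory.variance_of_integral_eq_zero hSmem.aemeasurable hS0] at h1
    rw [h1, ProbabilityTheory.variance_of_integral_eq_zero hm.aemeasurable h0]
    simp only [Finset.sum_const, Finset.card_univ, Fintype.card_fin, nsmul_eq_mul]
    gcongr
    have h2 : ∫ x, h x ^ 2 ∂μ ≤ ∫ _, M ^ 2 ∂μ := integral_mono hmem.integrable_sq
      (integrable_const _) fun x => sq_le_sq' (neg_le_of_abs_le (hM x)) (le_of_abs_le (hM x))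
    simpa using h2
  have habs : ∫ x, |S x| ∂P ≤ M * √n := by
    refine le_of_sq_le_sq ?_ (by positivity)
    have h1 := ProbabilityTheory.variance_nonneg |S| P
    rw [ProbabilityTheory.variance_eq_sub hSmem.abs] at h1
    simp only [Pi.pow_apply, Pi.abs_apply, sq_abs] at h1
    rw [mul_pow, Real.sq_sqrt (by positivity)]
    linarith
  refine le_trans (integral_mono_of_nonneg (ae_of_all _ fun x => le_max_right _ _)
    (hSmem.integrable one_le_two).abs (ae_of_all _ fun x => ?_)) habs
  simp only [hS, Finset.sum_apply]
  exact max_le (le_abs_self _) (abs_nonneg _)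

/-- A dimension-free bound with arbitrary constants self-improves to the dual form of the
transport-entropy inequality, with sharp constants. -/
lemma integral_exp_infConv_le_of_dimension_free {X : Type*} [MetricSpace X]
    [TopologicalSpace.SeparableSpace X] [MeasurableSpace X] [BorelSpace X] {α : ℝ → ℝ}
    (hα : IsYoung α) {μ : Measure X} [IsProbabilityMeasure μ] {a b c : ℝ} (ha : 0 < a)
    (hb : 0 < b) (hc : 0 < c)
    (H : ∀ n : ℕ, 0 < n →
        ∀ f : (Fin n → X) → ℝ, Continuous f → IsBoundedFun f → (∀ x, 0 ≤ f x) →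
          ∫ x, Real.exp (c * QInfN α f x) ∂(Measure.pi fun _ : Fin n => μ) ≤
            a * Real.exp (b * ∫ x, f x ∂(Measure.pi fun _ : Fin n => μ)))
    {h : X → ℝ} (hh : IsBoundedFun h) (hhc : Continuous h) :
    ∫ x, Real.exp (c * infConv (fun x y => α (dist x y)) h x) ∂μ ≤
      Real.exp (c * ∫ x, h x ∂μ) := by
  have : Nonempty X := nonempty_of_isProbabilityMeasure μ
  obtain ⟨M, hM⟩ := id hh
  set m := ∫ x, h x ∂μ with hm
  set Q := infConv (fun x y : X => α (dist x y)) h with hQ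
  have hmM : |m| ≤ M := abs_integral_le_of_abs_le μ hM
  have hM' : ∀ x, |h x - m| ≤ 2 * M := fun x => (abs_sub _ _).trans (by linarith [hM x])
  have hInt : ∫ x, (h x - m) ∂μ = 0 := by
    rw [integral_sub (hh.integrable hhc.measurable μ) (integrable_const _)]
    simp [hm]
  suffices hA : ∫ x, Real.exp (c * (Q x - m)) ∂μ ≤ 1 by
    have heq : ∀ x, Real.exp (c * (Q x - m)) = Real.exp (c * Q x) / Real.exp (c * m) := fun x => by
      rw [mul_sub, Real.exp_sub]
    simp_rw [heq] at hA
    rwa [integral_div, div_le_one (Real.exp_pos _)] at hA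
  refine le_one_of_pow_le_mul_exp_sqrt (a := a) (s := b * (2 * M)) fun n hn => ?_
  set f : (Fin n → X) → ℝ := fun x => max (∑ i, (h (x i) - m)) 0 with hf
  have hfc : Continuous f := by fun_prop
  have hfb : IsBoundedFun f := by
    refine ⟨n * (2 * M), fun x => ?_⟩
    rw [abs_of_nonneg (le_max_right _ _)]
    refine max_le ((Finset.sum_le_card_nsmul _ _ (2 * M) fun i _ =>
      le_of_abs_le (hM' _)).trans (by simp)) ?_
    have : 0 ≤ M := (abs_nonneg _).trans hmM
    positivity
  have hQf : ∀ x, ∑ i, (Q (x i) - m) ≤ QInfN α f x := by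
    refine fun x => le_ciInf fun y => ?_
    calc ∑ i, (Q (x i) - m) ≤ ∑ i, ((h (y i) - m) + α (dist (x i) (y i))) := by
          refine Finset.sum_le_sum fun i _ => ?_
          have := infConv_le (fun x y : X => hα.nonneg (dist x y)) hh (x i) (y i)
          linarith
      _ ≤ f y + ∑ i, α (dist (x i) (y i)) := by
          rw [Finset.sum_add_distrib]
          gcongr
          exact le_max_left _ _
  calc (∫ x, Real.exp (c * (Q x - m)) ∂μ) ^ n
      = ∫ x, ∏ i, Real.exp (c * (Q (x i) - m)) ∂(Measure.pi fun _ : Fin n => μ) := by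
        rw [integral_fintype_prod_eq_pow (fun x => Real.exp (c * (Q x - m))), Fintype.card_fin]
    _ ≤ ∫ x, Real.exp (c * QInfN α f x) ∂(Measure.pi fun _ : Fin n => μ) := by
        refine integral_mono_of_nonneg (ae_of_all _ fun x => by positivity)
          (((isBoundedFun_QInfN hα hfb).const_mul c).exp.integrable
            ((measurable_QInfN hα hfb).const_mul c).exp _) (ae_of_all _ fun x => ?_)
        simp only
        rw [← Real.exp_sum, ← Finset.mul_sum]
        gcongr
        exact hQf x
    _ ≤ a * Real.exp (b * ∫ x, f x ∂(Measure.pi fun _ : Fin n => μ)) :=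
        H n hn f hfc hfb fun x => le_max_right _ _
    _ ≤ a * Real.exp (b * (2 * M) * √n) := by
        rw [mul_assoc b]
        gcongr
        exact integral_posPart_sum_le μ hM' (hhc.measurable.sub_const m) hInt n

end Tightening

section Kantorovich

/-- Kantorovich duality for finite spaces. -/
lemma exists_finite_coupling_of_dual_bound {ι κ : Type*} [Fintype ι] [Fintype κ] {p : ι → ℝ}
    {q : κ → ℝ} (hp : ∀ i, 0 ≤ p i) (hq : ∀ j, 0 ≤ q j) (hp1 : ∑ i, p i = 1) (hq1 : ∑ j, q j = 1)
    {k : ι → κ → ℝ} {C : ℝ}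
    (H : ∀ (φ : ι → ℝ) (ψ : κ → ℝ), (∀ i j, φ i - ψ j ≤ k i j) →
      ∑ i, p i * φ i - ∑ j, q j * ψ j ≤ C) :
    ∃ w : ι → κ → ℝ, (∀ i j, 0 ≤ w i j) ∧ (∀ i, ∑ j, w i j = p i) ∧ (∀ j, ∑ i, w i j = q j) ∧
      ∑ i, ∑ j, w i j * k i j ≤ C := by
  classical
  let T : (ι × κ → ℝ) →ₗ[ℝ] (ι → ℝ) × (κ → ℝ) × ℝ :=
    { toFun := fun w => (fun i => ∑ j, w (i, j), fun j => ∑ i, w (i, j),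
        ∑ i, ∑ j, w (i, j) * k i j)
      map_add' := fun v w => by
        ext <;> simp [Finset.sum_add_distrib, add_mul]
      map_smul' := fun a w => by
        ext <;> simp [Finset.mul_sum, mul_assoc] }
  by_cases hdisj : Disjoint (T '' stdSimplex ℝ (ι × κ)) ({p} ×ˢ {q} ×ˢ Iic C)
  · exfalso
    obtain ⟨f, u, v, hfu, huv, hvf⟩ := geometric_hahn_banach_compact_closed
      ((convex_stdSimplex ℝ (ι × κ)).linear_image T)
      ((isCompact_stdSimplex ℝ (ι × κ)).image T.continuous_of_finiteDimensional)
      ((convex_singleton p).prod ((convex_singleton q).prod (convex_Iic C)))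
      (isClosed_singleton.prod (isClosed_singleton.prod isClosed_Iic)) hdisj
    set φ : ι → ℝ := fun i => f (Pi.single i 1, 0, 0) with hφ
    set ψ : κ → ℝ := fun j => f (0, Pi.single j 1, 0) with hψ
    set l : ℝ := f (0, 0, 1) with hl
    have hf : ∀ r s t, f (r, s, t) = ∑ i, r i * φ i + ∑ j, s j * ψ j + t * l := by
      intro r s t
      have h1 : ((r, s, t) : (ι → ℝ) × (κ → ℝ) × ℝ) =
          ∑ i, r i • ((Pi.single i 1, 0, 0) : (ι → ℝ) × (κ → ℝ) × ℝ) +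
          ∑ j, s j • ((0, Pi.single j 1, 0) : (ι → ℝ) × (κ → ℝ) × ℝ) + t • (0, 0, 1) := by
        ext <;> simp [Prod.fst_sum, Prod.snd_sum, Finset.sum_apply, Pi.single_apply]
      rw [h1]
      simp only [map_add, map_sum, map_smul, smul_eq_mul, hφ, hψ, hl]
    have hpt : ∀ i j, φ i + ψ j + k i j * l < u := by
      intro i j
      have := hfu _ ⟨Pi.single (i, j) 1, single_mem_stdSimplex ℝ (i, j), rfl⟩
      simp only [T, LinearMap.coe_mk, AddHom.coe_mk] at this
      rw [hf] at this
      simpa [Pi.single_apply, Prod.ext_iff, ite_and] using this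
    have htgt : ∀ t ≤ C, v < ∑ i, p i * φ i + ∑ j, q j * ψ j + t * l := fun t ht => by
      rw [← hf]
      exact hvf _ ⟨rfl, rfl, ht⟩
    have hl0 : l ≤ 0 := by
      by_contra! h
      have := htgt (min C ((v - ∑ i, p i * φ i - ∑ j, q j * ψ j) / l)) (min_le_left _ _)
      have h2 : min C ((v - ∑ i, p i * φ i - ∑ j, q j * ψ j) / l) * l ≤
          (v - ∑ i, p i * φ i - ∑ j, q j * ψ j) / l * l := by
        gcongr
        exact min_le_right _ _
      rw [div_mul_cancel₀ _ h.ne'] at h2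
      linarith
    have hC := htgt C le_rfl
    rcases hl0.eq_or_lt with h | h
    · have hsum : ∑ i, p i * φ i + ∑ j, q j * ψ j = ∑ i, ∑ j, p i * q j * (φ i + ψ j) := by
        simp_rw [mul_add, Finset.sum_add_distrib, mul_right_comm _ (q _) (φ _), ← Finset.mul_sum,
          hq1, mul_assoc (p _) (q _), ← Finset.mul_sum, ← Finset.sum_mul, hp1]
        simp
      have hle : ∑ i, ∑ j, p i * q j * (φ i + ψ j) ≤ ∑ i, ∑ j, p i * q j * u := by
        gcongr with i _ j _
        · exact mul_nonneg (hp i) (hq j)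
        · have := hpt i j
          rw [h] at this
          linarith
      simp_rw [← Finset.sum_mul, ← Finset.mul_sum, hq1, mul_one, hp1] at hle
      rw [h] at hC
      linarith
    · have hl' : 0 < -l := by linarith
      have := H (fun i => (φ i - u) / -l) (fun j => -ψ j / -l) fun i j => by
        rw [← sub_div, div_le_iff₀ hl']
        have := hpt i j
        linarith
      simp_rw [← mul_div_assoc, mul_neg, mul_sub] at this
      rw [← Finset.sum_div, ← Finset.sum_div, ← sub_div, div_le_iff₀ hl',
        Finset.sum_sub_distrib, ← Finset.sum_mul, hp1, Finset.sum_neg_distrib] at this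
      linarith
  · obtain ⟨_, ⟨w, hw, rfl⟩, h1, h2, h3⟩ := not_disjoint_iff.1 hdisj
    exact ⟨fun i j => w (i, j), fun i j => hw.1 _, fun i => congrFun h1 i, fun j => congrFun h2 j,
      h3⟩

/-- A coupling of the cell masses of a finite partition lifts to a coupling of the measures. -/
lemma exists_coupling_of_cells {X ι : Type*} [MeasurableSpace X] [Fintype ι] {ν μ : Measure X}
    [IsProbabilityMeasure ν] [IsProbabilityMeasure μ] {r : X → ι}
    (hr : ∀ i, MeasurableSet (r ⁻¹' {i})) {w : ι → ι → ℝ} (hw : ∀ i j, 0 ≤ w i j)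
    (hν : ∀ i, ∑ j, w i j = ν.real (r ⁻¹' {i})) (hμ : ∀ j, ∑ i, w i j = μ.real (r ⁻¹' {j})) :
    ∃ π : Measure (X × X), π.map Prod.fst = ν ∧ π.map Prod.snd = μ ∧
      ∀ i j, π.real ((r ⁻¹' {i}) ×ˢ (r ⁻¹' {j})) = w i j := by
  classical
  have hwν : ∀ i, ν (r ⁻¹' {i}) = 0 → ∀ j, w i j = 0 := fun i hi j =>
    (Finset.sum_eq_zero_iff_of_nonneg fun j _ => hw i j).1
      ((hν i).trans (by simp [measureReal_def, hi])) j (Finset.mem_univ j)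
  have hwμ : ∀ j, μ (r ⁻¹' {j}) = 0 → ∀ i, w i j = 0 := fun j hj i =>
    (Finset.sum_eq_zero_iff_of_nonneg fun i _ => hw i j).1
      ((hμ j).trans (by simp [measureReal_def, hj])) i (Finset.mem_univ i)
  have hpart : ∀ (ρ : Measure X) [IsProbabilityMeasure ρ] (t : Set X), MeasurableSet t →
      ∑ i, ENNReal.ofReal (ρ.real (r ⁻¹' {i})) * ProbabilityTheory.cond ρ (r ⁻¹' {i}) t = ρ t := by
    intro ρ _ t ht
    have hU : t = ⋃ i, r ⁻¹' {i} ∩ t := by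
      ext x
      simp
    conv_rhs => rw [hU]
    rw [measure_iUnion, tsum_fintype]
    · refine Finset.sum_congr rfl fun i _ => ?_
      rw [ofReal_measureReal, mul_comm, ProbabilityTheory.cond_mul_eq_inter (hr i)]
    · refine fun i j hij => disjoint_left.2 ?_
      rintro x ⟨rfl, -⟩ ⟨rfl, -⟩
      exact hij rfl
    · exact fun i => (hr i).inter ht
  have hone : ∀ (ρ : Measure X) [IsProbabilityMeasure ρ] (i : ι) (t : Set X), r ⁻¹' {i} ⊆ t →
      ρ (r ⁻¹' {i}) ≠ 0 → ProbabilityTheory.cond ρ (r ⁻¹' {i}) t = 1 := by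
    intro ρ _ i t hit hi
    rw [ProbabilityTheory.cond_apply (hr i), inter_eq_left.2 hit,
      ENNReal.inv_mul_cancel hi (measure_ne_top _ _)]
  set π : Measure (X × X) := ∑ i, ∑ j, ENNReal.ofReal (w i j) •
    (ProbabilityTheory.cond ν (r ⁻¹' {i})).prod (ProbabilityTheory.cond μ (r ⁻¹' {j})) with hπ
  have hπ' : ∀ s t : Set X, π (s ×ˢ t) = ∑ i, ∑ j, ENNReal.ofReal (w i j) *
      (ProbabilityTheory.cond ν (r ⁻¹' {i}) s * ProbabilityTheory.cond μ (r ⁻¹' {j}) t) := by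
    intro s t
    simp [hπ, Measure.finsetSum_apply, Measure.prod_prod]
  refine ⟨π, ?_, ?_, ?_⟩
  · ext s hs
    rw [Measure.map_apply measurable_fst hs, ← prod_univ, hπ', ← hpart ν s hs]
    refine Finset.sum_congr rfl fun i _ => ?_
    rw [← hν, ENNReal.ofReal_sum_of_nonneg fun j _ => hw i j, Finset.sum_mul]
    refine Finset.sum_congr rfl fun j _ => ?_
    by_cases hj : μ (r ⁻¹' {j}) = 0
    · simp [hwμ j hj i]
    · rw [hone μ j univ (subset_univ _) hj, mul_one]
  · ext s hs
    rw [Measure.map_apply measurable_snd hs, ← univ_prod, hπ', ← hpart μ s hs, Finset.sum_comm]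
    refine Finset.sum_congr rfl fun j _ => ?_
    rw [← hμ, ENNReal.ofReal_sum_of_nonneg fun i _ => hw i j, Finset.sum_mul]
    refine Finset.sum_congr rfl fun i _ => ?_
    by_cases hi : ν (r ⁻¹' {i}) = 0
    · simp [hwν i hi j]
    · rw [hone ν i univ (subset_univ _) hi, one_mul]
  · intro i j
    have hzero : ∀ (ρ : Measure X) (i i' : ι), i' ≠ i →
        ProbabilityTheory.cond ρ (r ⁻¹' {i'}) (r ⁻¹' {i}) = 0 := by
      intro ρ i i' hne
      rw [ProbabilityTheory.cond_apply (hr i'), ← preimage_inter,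
        singleton_inter_eq_empty.2 (by simpa using hne)]
      simp
    rw [measureReal_def, hπ', Finset.sum_eq_single i, Finset.sum_eq_single j]
    · by_cases hi : ν (r ⁻¹' {i}) = 0
      · simp [hwν i hi j]
      by_cases hj : μ (r ⁻¹' {j}) = 0
      · simp [hwμ j hj i]
      rw [hone ν i _ subset_rfl hi, hone μ j _ subset_rfl hj]
      simp [hw i j]
    · intro j' _ hne
      simp [hzero μ j j' hne]
    · simp
    · intro i' _ hne
      simp [hzero ν i i' hne]
    · simp

/-- Every point is measurably assigned to a nearby point of a dense sequence. -/
lemma exists_measurable_index {X : Type*} [MetricSpace X] [TopologicalSpace.SeparableSpace X]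
    [Nonempty X] [MeasurableSpace X] [BorelSpace X] {δ : ℝ} (hδ : 0 < δ) :
    ∃ r : X → ℕ, Measurable r ∧ ∀ x, dist x (TopologicalSpace.denseSeq X (r x)) < δ := by
  classical
  have hex : ∀ x : X, ∃ n, dist x (TopologicalSpace.denseSeq X n) < δ := fun x => by
    obtain ⟨n, hn⟩ := (TopologicalSpace.denseRange_denseSeq X).exists_dist_lt x hδ
    exact ⟨n, hn⟩
  exact ⟨fun x => Nat.find (hex x), measurable_find hex fun n =>
    (isOpen_lt (continuous_id.dist continuous_const) continuous_const).measurableSet,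
    fun x => Nat.find_spec (hex x)⟩

lemma tendsto_measureReal_ge_index {X : Type*} [MeasurableSpace X] (ρ : Measure X)
    [IsFiniteMeasure ρ] {r : X → ℕ} (hr : Measurable r) :
    Tendsto (fun N : ℕ => ρ.real {x | N ≤ r x}) atTop (𝓝 0) := by
  have h := tendsto_measure_iInter_atTop (μ := ρ) (s := fun N : ℕ => {x | N ≤ r x})
    (fun N => (measurableSet_le measurable_const hr).nullMeasurableSet)
    (fun M N hMN x hx => hMN.trans hx) ⟨0, measure_ne_top _ _⟩
  have hempty : ⋂ N : ℕ, {x | N ≤ r x} = ∅ := by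
    ext x
    simp only [mem_iInter, mem_ofPred_eq, mem_empty_iff_false, iff_false, not_forall, not_le]
    exact ⟨r x + 1, Nat.lt_succ_self _⟩
  rw [hempty, measure_empty] at h
  simpa [measureReal_def, Function.comp_def] using (ENNReal.tendsto_toReal ENNReal.zero_ne_top).comp h

lemma integral_comp_eq_sum {Y ι : Type*} [MeasurableSpace Y] [Fintype ι] [MeasurableSpace ι]
    [MeasurableSingletonClass ι] (ρ : Measure Y) [IsFiniteMeasure ρ] {s : Y → ι}
    (hs : Measurable s) (φ : ι → ℝ) :
    ∫ x, φ (s x) ∂ρ = ∑ i, ρ.real (s ⁻¹' {i}) * φ i := by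
  have hφ : Measurable φ := measurable_of_finite φ
  rw [← integral_map hs.aemeasurable hφ.aestronglyMeasurable, integral_fintype (.of_finite)]
  simp [map_measureReal_apply hs (measurableSet_singleton _)]

/-- Approximate Kantorovich duality for bounded uniformly continuous costs, by discretization. -/
lemma exists_coupling_integral_le_add {X : Type*} [MetricSpace X]
    [TopologicalSpace.SeparableSpace X] [MeasurableSpace X] [BorelSpace X] {ν μ : Measure X}
    [IsProbabilityMeasure ν] [IsProbabilityMeasure μ] {k : X → X → ℝ} {B C : ℝ}
    (hk : ∀ x y, 0 ≤ k x y) (hkB : ∀ x y, k x y ≤ B)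
    (hku : UniformContinuous fun z : X × X => k z.1 z.2)
    (H : ∀ φ ψ : X → ℝ, IsBoundedFun φ → Measurable φ → IsBoundedFun ψ → Measurable ψ →
      (∀ x y, φ x - ψ y ≤ k x y) → ∫ x, φ x ∂ν - ∫ y, ψ y ∂μ ≤ C) {ε : ℝ} (hε : 0 < ε) :
    ∃ π : Measure (X × X), π.map Prod.fst = ν ∧ π.map Prod.snd = μ ∧
      ∫ z, k z.1 z.2 ∂π ≤ C + ε := by
  have := UniformSpace.secondCountable_of_separable X
  have hX : Nonempty X := nonempty_of_isProbabilityMeasure μ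
  have hB : 0 ≤ B := (hk hX.some hX.some).trans (hkB _ _)
  set η : ℝ := ε / (2 + 2 * B) with hη
  have hη0 : 0 < η := by positivity
  obtain ⟨δ, hδ, hδk⟩ := Metric.uniformContinuous_iff.1 hku η hη0
  obtain ⟨r, hrm, hrδ⟩ := exists_measurable_index (X := X) hδ
  set u := TopologicalSpace.denseSeq X with hu
  have hclose : ∀ x y, |k x y - k (u (r x)) (u (r y))| < η := fun x y => by
    have := hδk (a := (x, y)) (b := (u (r x), u (r y))) (max_lt (hrδ x) (hrδ y))
    rwa [Real.dist_eq] at this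
  obtain ⟨N, hNν, hNμ⟩ := (((tendsto_measureReal_ge_index ν hrm).eventually_lt_const hη0).and
    ((tendsto_measureReal_ge_index μ hrm).eventually_lt_const hη0)).exists
  let s : X → Fin (N + 1) := fun x => ⟨min (r x) N, Nat.lt_succ_of_le (min_le_right _ _)⟩
  have hsm : Measurable s := (measurable_from_top (f := fun n : ℕ =>
    (⟨min n N, Nat.lt_succ_of_le (min_le_right _ _)⟩ : Fin (N + 1)))).comp hrm
  have hsr : ∀ x, (s x : ℕ) < N → (s x : ℕ) = r x := fun x hx => by
    simp only [s] at hx ⊢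
    omega
  have hsN : ∀ x, ¬ (s x : ℕ) < N → N ≤ r x := fun x hx => by
    simp only [s] at hx
    omega
  let κ : Fin (N + 1) → Fin (N + 1) → ℝ := fun i j =>
    if (i : ℕ) < N ∧ (j : ℕ) < N then max (k (u i) (u j) - η) 0 else 0
  have hκk : ∀ x y, κ (s x) (s y) ≤ k x y := fun x y => by
    simp only [κ]
    split_ifs with h
    · rw [hsr x h.1, hsr y h.2]
      have := (abs_lt.1 (hclose x y)).1
      exact max_le (by linarith) (hk x y)
    · exact hk x y
  have hκ0 : ∀ i j, 0 ≤ κ i j := fun i j => by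
    simp only [κ]
    split_ifs
    · exact le_max_right _ _
    · exact le_rfl
  have hfib : ∀ i, MeasurableSet (s ⁻¹' {i}) := fun i => hsm (measurableSet_singleton i)
  have hmass : ∀ (ρ : Measure X) [IsProbabilityMeasure ρ], ∑ i, ρ.real (s ⁻¹' {i}) = 1 := by
    intro ρ _
    simpa using (integral_comp_eq_sum ρ hsm fun _ => 1).symm
  obtain ⟨w, hw, hwν, hwμ, hwC⟩ := exists_finite_coupling_of_dual_bound
    (fun i => measureReal_nonneg (μ := ν) (s := s ⁻¹' {i}))
    (fun i => measureReal_nonneg (μ := μ) (s := s ⁻¹' {i})) (hmass ν) (hmass μ)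
    (k := κ) (C := C) fun φ ψ hφψ => by
      rw [← integral_comp_eq_sum ν hsm, ← integral_comp_eq_sum μ hsm]
      have hb : ∀ φ : Fin (N + 1) → ℝ, IsBoundedFun fun x => φ (s x) := fun φ =>
        ⟨∑ i, |φ i|, fun x => Finset.single_le_sum (f := fun i => |φ i|)
          (fun i _ => abs_nonneg _) (Finset.mem_univ (s x))⟩
      exact H _ _ (hb φ) (measurable_from_top.comp hsm) (hb ψ) (measurable_from_top.comp hsm)
        fun x y => (hφψ _ _).trans (hκk x y)
  obtain ⟨π, hπ1, hπ2, hπ⟩ := exists_coupling_of_cells hfib hw hwν hwμ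
  refine ⟨π, hπ1, hπ2, ?_⟩
  have hπp : IsProbabilityMeasure π := isProbabilityMeasure_of_map_fst hπ1
  have hκint : ∫ z, κ (s z.1) (s z.2) ∂π ≤ C := by
    have h := integral_comp_eq_sum π ((hsm.comp measurable_fst).prodMk (hsm.comp measurable_snd))
      fun p => κ p.1 p.2
    simp only [Function.comp_def] at h
    rw [h, Fintype.sum_prod_type]
    refine le_of_eq_of_le (Finset.sum_congr rfl fun i _ => Finset.sum_congr rfl fun j _ => ?_) hwC
    rw [← hπ i j]
    congr 2
    ext z
    simp
  have hE : MeasurableSet {x | N ≤ r x} := measurableSet_le measurable_const hrm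
  have hE1 : MeasurableSet (Prod.fst ⁻¹' {x | N ≤ r x} : Set (X × X)) := measurable_fst hE
  have hE2 : MeasurableSet (Prod.snd ⁻¹' {x | N ≤ r x} : Set (X × X)) := measurable_snd hE
  have hm1 : π.real (Prod.fst ⁻¹' {x | N ≤ r x}) < η := by
    rwa [← map_measureReal_apply measurable_fst hE, hπ1]
  have hm2 : π.real (Prod.snd ⁻¹' {x | N ≤ r x}) < η := by
    rwa [← map_measureReal_apply measurable_snd hE, hπ2]
  have hpt : ∀ z : X × X, k z.1 z.2 ≤ κ (s z.1) (s z.2) + 2 * η +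
      ((Prod.fst ⁻¹' {x | N ≤ r x}).indicator (fun _ => B) z +
        (Prod.snd ⁻¹' {x | N ≤ r x}).indicator (fun _ => B) z) := by
    intro z
    have h1 : 0 ≤ (Prod.fst ⁻¹' {x | N ≤ r x}).indicator (fun _ => B) z :=
      indicator_nonneg (fun _ _ => hB) z
    have h2 : 0 ≤ (Prod.snd ⁻¹' {x | N ≤ r x}).indicator (fun _ => B) z :=
      indicator_nonneg (fun _ _ => hB) z
    have := hκ0 (s z.1) (s z.2)
    have hkz := hkB z.1 z.2
    by_cases hz1 : (s z.1 : ℕ) < N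
    · by_cases hz2 : (s z.2 : ℕ) < N
      · have hκ : k (u (r z.1)) (u (r z.2)) - η ≤ κ (s z.1) (s z.2) := by
          simp only [κ, if_pos (And.intro hz1 hz2), hsr _ hz1, hsr _ hz2]
          exact le_max_left _ _
        have := (abs_lt.1 (hclose z.1 z.2)).2
        linarith
      · have : (Prod.snd ⁻¹' {x | N ≤ r x}).indicator (fun _ => B) z = B :=
          indicator_of_mem (show z ∈ Prod.snd ⁻¹' {x | N ≤ r x} from hsN _ hz2) _
        linarith
    · have : (Prod.fst ⁻¹' {x | N ≤ r x}).indicator (fun _ => B) z = B :=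
        indicator_of_mem (show z ∈ Prod.fst ⁻¹' {x | N ≤ r x} from hsN _ hz1) _
      linarith
  have hki : Integrable (fun z : X × X => k z.1 z.2) π :=
    Integrable.of_bound hku.continuous.measurable.aestronglyMeasurable B
      (ae_of_all _ fun z => by rw [Real.norm_of_nonneg (hk _ _)]; exact hkB _ _)
  have hκi : Integrable (fun z : X × X => κ (s z.1) (s z.2)) π := by
    refine Integrable.of_bound (Measurable.aestronglyMeasurable ?_) B (ae_of_all _ fun z => ?_)
    · exact (measurable_of_finite fun p : Fin (N + 1) × Fin (N + 1) => κ p.1 p.2).comp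
        ((hsm.comp measurable_fst).prodMk (hsm.comp measurable_snd))
    · rw [Real.norm_of_nonneg (hκ0 _ _)]
      exact (hκk _ _).trans (hkB _ _)
  have hi1 := (integrable_const (μ := π) B).indicator hE1
  have hi2 := (integrable_const (μ := π) B).indicator hE2
  have hi3 := hκi.add (integrable_const (μ := π) (2 * η))
  calc ∫ z, k z.1 z.2 ∂π ≤ _ := integral_mono hki (hi3.add (hi1.add hi2)) hpt
    _ = ∫ z, κ (s z.1) (s z.2) ∂π + 2 * η + (π.real (Prod.fst ⁻¹' {x | N ≤ r x}) * B +
        π.real (Prod.snd ⁻¹' {x | N ≤ r x}) * B) := by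
      rw [integral_add' hi3 (hi1.add hi2), integral_add' hi1 hi2,
        integral_add' hκi (integrable_const _), integral_indicator_const _ hE1,
        integral_indicator_const _ hE2]
      simp
    _ ≤ C + 2 * η + (η * B + η * B) := by gcongr
    _ = C + ε := by
      rw [hη]
      field_simp
      ring

end Kantorovich

lemma IsYoung.uniformContinuous_min_dist {X : Type*} [MetricSpace X] {α : ℝ → ℝ}
    (hα : IsYoung α) {R : ℝ} (hR : 0 ≤ R) :
    UniformContinuous fun z : X × X => α (min (dist z.1 z.2) R) := by
  have h1 : UniformContinuous fun t : Icc (0 : ℝ) R => α t :=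
    CompactSpace.uniformContinuous_of_continuous (hα.continuous.comp continuous_subtype_val)
  have h2 := h1.comp ((LipschitzWith.projIcc hR).uniformContinuous.comp
    (uniformContinuous_dist (α := X)))
  refine h2.congr fun z => ?_
  simp [Set.coe_projIcc, min_comm R, hR]

lemma IsYoung.monotone_of_nonneg {α : ℝ → ℝ} (hα : IsYoung α) {s t : ℝ} (hs : 0 ≤ s)
    (hst : s ≤ t) : α s ≤ α t :=
  hα.mono.monotoneOn hs (hs.trans hst) hst

section DualBound

variable {X : Type*} [MetricSpace X] [MeasurableSpace X] [BorelSpace X]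

/-- A bound on the dual functional over inf-convolutions of bounded continuous functions extends
to all admissible pairs of bounded measurable functions for a smaller uniformly continuous cost. -/
lemma integral_sub_integral_le_of_infConv {ν μ : Measure X} [IsProbabilityMeasure ν]
    [IsProbabilityMeasure μ] {k K : X → X → ℝ} {B C : ℝ} (hk : ∀ x y, 0 ≤ k x y)
    (hkB : ∀ x y, k x y ≤ B) (hku : UniformContinuous fun z : X × X => k z.1 z.2)
    (hkK : ∀ x y, k x y ≤ K x y) (hK0 : ∀ x, K x x = 0) (hKc : ∀ y, Continuous fun x => K x y)
    (hC : ∀ h : X → ℝ, IsBoundedFun h → Continuous h →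
      ∫ x, infConv K h x ∂ν - ∫ y, h y ∂μ ≤ C)
    {φ ψ : X → ℝ} (hφ : IsBoundedFun φ) (hφm : Measurable φ) (hψ : IsBoundedFun ψ)
    (hψm : Measurable ψ) (hφψ : ∀ x y, φ x - ψ y ≤ k x y) :
    ∫ x, φ x ∂ν - ∫ y, ψ y ∂μ ≤ C := by
  have hX : Nonempty X := nonempty_of_isProbabilityMeasure μ
  have hK : ∀ x y, 0 ≤ K x y := fun x y => (hk x y).trans (hkK x y)
  have hφ' := hφ
  obtain ⟨M, hM⟩ := hφ'
  have hbdd : ∀ y, BddAbove (range fun x => φ x - k x y) := fun y => by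
    refine ⟨M, ?_⟩
    rintro _ ⟨x, rfl⟩
    have := le_of_abs_le (hM x)
    have := hk x y
    dsimp only
    linarith
  set h : X → ℝ := fun y => ⨆ x, (φ x - k x y) with hh
  have hle : ∀ x y, φ x - k x y ≤ h y := fun x y => le_ciSup (hbdd y) x
  have hhb : IsBoundedFun h := by
    refine ⟨M + B, fun y => abs_le.2 ⟨?_, ciSup_le fun x => ?_⟩⟩
    · have := hle y y
      have := neg_le_of_abs_le (hM y)
      have := hkB y y
      linarith
    · have := le_of_abs_le (hM x)
      have := hk x y
      have := hkB x y
      linarith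
  have hhc : Continuous h := by
    refine Metric.continuous_iff.2 fun y ε hε => ?_
    obtain ⟨δ, hδ, hδk⟩ := Metric.uniformContinuous_iff.1 hku (ε / 2) (half_pos hε)
    have hstep : ∀ y y', dist y' y < δ → h y' ≤ h y + ε / 2 := fun y y' hyy' =>
      ciSup_le fun x => by
        have h1 := hδk (a := (x, y')) (b := (x, y)) (max_lt (by simpa using hδ) hyy')
        rw [Real.dist_eq] at h1
        have := (abs_lt.1 h1).1
        have := hle x y
        dsimp only at *
        linarith
    refine ⟨δ, hδ, fun y' hyy' => ?_⟩
    have h1 := hstep y y' hyy'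
    have h2 := hstep y' y (by rwa [dist_comm])
    rw [Real.dist_eq, abs_lt]
    constructor <;> linarith
  have hφle : ∀ x, φ x ≤ infConv K h x := fun x => le_ciInf fun y => by
    have := hle x y
    have := hkK x y
    linarith
  have hψle : ∀ y, h y ≤ ψ y := fun y => ciSup_le fun x => by
    have := hφψ x y
    linarith
  have h1 := integral_mono (hφ.integrable hφm ν) ((isBoundedFun_infConv hK hK0 hhb).integrable
    (upperSemicontinuous_infConv hK hKc hhb).measurable ν) hφle
  have h2 := integral_mono (hhb.integrable hhc.measurable μ) (hψ.integrable hψm μ) hψle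
  have h3 := hC h hhb hhc
  linarith

/-- The set of couplings of two probability measures is compact. -/
lemma isCompact_couplings [CompleteSpace X] [TopologicalSpace.SeparableSpace X]
    (ν μ : Measure X) [IsProbabilityMeasure ν] [IsProbabilityMeasure μ] :
    IsCompact {π : ProbabilityMeasure (X × X) |
      (π : Measure (X × X)).map Prod.fst = ν ∧ (π : Measure (X × X)).map Prod.snd = μ} := by
  have := UniformSpace.secondCountable_of_separable X
  set S := {π : ProbabilityMeasure (X × X) |
      (π : Measure (X × X)).map Prod.fst = ν ∧ (π : Measure (X × X)).map Prod.snd = μ} with hS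
  have hcl : IsClosed S := by
    let ν' : ProbabilityMeasure X := ⟨ν, inferInstance⟩
    let μ' : ProbabilityMeasure X := ⟨μ, inferInstance⟩
    have h1 := (isClosed_singleton (x := ν')).preimage
      (ProbabilityMeasure.continuous_map (continuous_fst (X := X) (Y := X)))
    have h2 := (isClosed_singleton (x := μ')).preimage
      (ProbabilityMeasure.continuous_map (continuous_snd (X := X) (Y := X)))
    convert h1.inter h2 using 1
    ext π
    exact and_congr (Subtype.ext_iff (a1 := π.map _) (a2 := ν')).symm
      (Subtype.ext_iff (a1 := π.map _) (a2 := μ')).symm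
  rw [← hcl.closure_eq]
  refine isCompact_closure_of_isTightMeasureSet (IsTightMeasureSet.prodMk ?_ ?_)
  · refine (isTightMeasureSet_singleton (μ := ν)).subset ?_
    rintro _ ⟨_, ⟨π, hπ, rfl⟩, rfl⟩
    exact hπ.1
  · refine (isTightMeasureSet_singleton (μ := μ)).subset ?_
    rintro _ ⟨_, ⟨π, hπ, rfl⟩, rfl⟩
    exact hπ.2

/-- Kantorovich duality: a bound on the dual functional bounds the optimal transport cost. -/
lemma transportCost_le_of_dual_bound [CompleteSpace X] [TopologicalSpace.SeparableSpace X]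
    {α : ℝ → ℝ} (hα : IsYoung α) {ν μ : Measure X} [IsProbabilityMeasure ν]
    [IsProbabilityMeasure μ] {C : ℝ}
    (hC : ∀ h : X → ℝ, IsBoundedFun h → Continuous h →
      ∫ x, infConv (fun x y => α (dist x y)) h x ∂ν - ∫ y, h y ∂μ ≤ C) :
    transportCost α ν μ ≤ ENNReal.ofReal C := by
  have := UniformSpace.secondCountable_of_separable X
  let k : ℕ → X → X → ℝ := fun n x y => α (min (dist x y) n)
  have hmin : ∀ (n : ℕ) (x y : X), 0 ≤ min (dist x y) n := fun n x y =>
    le_min dist_nonneg n.cast_nonneg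
  have hk0 : ∀ n x y, 0 ≤ k n x y := fun n x y => hα.nonneg _
  have hkB : ∀ n x y, k n x y ≤ α n := fun n x y =>
    hα.monotone_of_nonneg (hmin n x y) (min_le_right _ _)
  have hkK : ∀ n x y, k n x y ≤ α (dist x y) := fun n x y =>
    hα.monotone_of_nonneg (hmin n x y) (min_le_left _ _)
  have hkmono : ∀ x y, Monotone fun n => k n x y := fun x y m n hmn =>
    hα.monotone_of_nonneg (hmin m x y) (min_le_min_left _ (Nat.cast_le.2 hmn))
  have hku : ∀ n, UniformContinuous fun z : X × X => k n z.1 z.2 := fun n =>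
    hα.uniformContinuous_min_dist n.cast_nonneg
  have hki : ∀ n (π : ProbabilityMeasure (X × X)),
      Integrable (fun z : X × X => k n z.1 z.2) (π : Measure (X × X)) :=
    fun n π => Integrable.of_bound (hku n).continuous.measurable.aestronglyMeasurable (α n)
      (ae_of_all _ fun z => by rw [Real.norm_of_nonneg (hk0 _ _ _)]; exact hkB _ _ _)
  set S := {π : ProbabilityMeasure (X × X) |
      (π : Measure (X × X)).map Prod.fst = ν ∧ (π : Measure (X × X)).map Prod.snd = μ} with hS
  have hScpt : IsCompact S := isCompact_couplings ν μ
  let T : ℕ → Set (ProbabilityMeasure (X × X)) := fun n =>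
    S ∩ {π | ∫ z, k n z.1 z.2 ∂(π : Measure (X × X)) ≤ C + 1 / ((n : ℝ) + 1)}
  have hTcl : ∀ n, IsClosed (T n) := fun n => by
    refine hScpt.isClosed.inter (isClosed_le ?_ continuous_const)
    exact ProbabilityMeasure.continuous_integral_boundedContinuousFunction
      (BoundedContinuousFunction.ofNormedAddCommGroup (fun z : X × X => k n z.1 z.2)
        (hku n).continuous (α n) fun z => by
          rw [Real.norm_of_nonneg (hk0 _ _ _)]; exact hkB _ _ _)
  have hTne : ∀ n, (T n).Nonempty := fun n => by
    obtain ⟨π, hπ1, hπ2, hπ⟩ := exists_coupling_integral_le_add (hk0 n) (hkB n) (hku n)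
      (fun φ ψ hφ hφm hψ hψm hφψ => integral_sub_integral_le_of_infConv (hk0 n) (hkB n) (hku n)
        (hkK n) (fun x => by simp [hα.zero])
        (fun y => hα.continuous.comp (continuous_id.dist continuous_const)) hC hφ hφm hψ hψm hφψ)
      (Nat.one_div_pos_of_nat (α := ℝ) (n := n))
    exact ⟨⟨π, isProbabilityMeasure_of_map_fst hπ1⟩, ⟨hπ1, hπ2⟩, hπ⟩
  have hTanti : ∀ n, T (n + 1) ⊆ T n := fun n π hπ => by
    refine ⟨hπ.1, ?_⟩
    refine (integral_mono (hki n π) (hki (n + 1) π) fun z => hkmono z.1 z.2 n.le_succ).trans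
      (hπ.2.trans ?_)
    gcongr
    exact n.le_succ
  obtain ⟨π, hπ⟩ := IsCompact.nonempty_iInter_of_sequence_nonempty_isCompact_isClosed T hTanti hTne
    (hScpt.of_isClosed_subset (hTcl 0) inter_subset_left) hTcl
  rw [mem_iInter] at hπ
  have hlim : Tendsto (fun n => ∫⁻ z, ENNReal.ofReal (k n z.1 z.2) ∂(π : Measure (X × X))) atTop
      (𝓝 (∫⁻ z, ENNReal.ofReal (α (dist z.1 z.2)) ∂(π : Measure (X × X)))) := by
    refine lintegral_tendsto_of_tendsto_of_monotone
      (fun n => (hku n).continuous.measurable.ennreal_ofReal.aemeasurable)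
      (ae_of_all _ fun z m n hmn => ENNReal.ofReal_le_ofReal (hkmono z.1 z.2 hmn))
      (ae_of_all _ fun z => ?_)
    obtain ⟨N, hN⟩ := exists_nat_ge (dist z.1 z.2)
    refine tendsto_const_nhds.congr' ?_
    filter_upwards [eventually_ge_atTop N] with n hn
    simp only [k]
    rw [min_eq_left (hN.trans (Nat.cast_le.2 hn))]
  have hlimC : Tendsto (fun n : ℕ => ENNReal.ofReal (C + 1 / ((n : ℝ) + 1))) atTop
      (𝓝 (ENNReal.ofReal C)) := by
    refine ENNReal.tendsto_ofReal ?_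
    simpa using (tendsto_const_nhds (x := C)).add tendsto_one_div_add_atTop_nhds_zero_nat
  have hle := le_of_tendsto_of_tendsto' hlim hlimC fun n => by
    rw [← ofReal_integral_eq_lintegral_ofReal (hki n π) (ae_of_all _ fun z => hk0 n z.1 z.2)]
    exact ENNReal.ofReal_le_ofReal (hπ n).2
  refine le_trans (sInf_le ?_) hle
  exact ⟨π, (hπ 0).1.1, (hπ 0).1.2, rfl⟩

end DualBound

theorem transport_entropy_iff_dimension_free_bound
    {X : Type*} [MetricSpace X] [CompleteSpace X] [TopologicalSpace.SeparableSpace X]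
    [MeasurableSpace X] [BorelSpace X]
    (α : ℝ → ℝ) (hα : IsYoung α)
    (μ : Measure X) [IsProbabilityMeasure μ] (c : ℝ) (hc : 0 < c) :
    TransportEntropy μ α (1 / c) ↔
      ∃ a > 0, ∃ b > 0, ∀ n : ℕ, 0 < n →
        ∀ f : (Fin n → X) → ℝ, Continuous f → IsBoundedFun f → (∀ x, 0 ≤ f x) →
          ∫ x, Real.exp (c * QInfN α f x) ∂(Measure.pi fun _ : Fin n => μ) ≤
            a * Real.exp (b * ∫ x, f x ∂(Measure.pi fun _ : Fin n => μ)) := by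
  have := UniformSpace.secondCountable_of_separable X
  constructor
  · intro hT
    refine ⟨1, one_pos, c, hc, fun n _ f hfc hfb _ => ?_⟩
    rw [one_mul]
    exact integral_exp_QInfN_le hα hc
      (fun h hh hm => hT.integral_exp_infConv_le hα hc hh hm) n f hfc hfb
  · rintro ⟨a, ha, b, hb, H⟩ ν hν
    have hX : Nonempty X := nonempty_of_isProbabilityMeasure μ
    by_cases hent : ν ≪ μ ∧ Integrable (fun x => Real.log (ν.rnDeriv μ x).toReal) ν
    · rw [relEnt, if_pos hent, ← ENNReal.ofReal_mul (by positivity)]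
      refine transportCost_le_of_dual_bound hα fun h hh hhc => ?_
      have hk : ∀ x y : X, 0 ≤ α (dist x y) := fun x y => hα.nonneg _
      have hb' := isBoundedFun_infConv (k := fun x y : X => α (dist x y)) hk
        (fun x => by simp [hα.zero]) hh
      have hm' := (upperSemicontinuous_infConv (k := fun x y : X => α (dist x y)) hk
        (fun y => hα.continuous.comp (continuous_id.dist continuous_const)) hh).measurable
      have hdv := integral_le_integral_llr_add_log (hb'.const_mul c) (hm'.const_mul c) hent.1 hent.2
      have hexp := integral_exp_infConv_le_of_dimension_free hα ha hb hc H hh hhc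
      have hlog := Real.log_le_log (integral_exp_pos
        ((hb'.const_mul c).exp.integrable (hm'.const_mul c).exp μ)) hexp
      rw [Real.log_exp] at hlog
      rw [integral_const_mul] at hdv
      rw [one_div, inv_mul_eq_div, le_div_iff₀ hc]
      simp only [llr] at hdv
      linarith
    · rw [relEnt, if_neg hent, ENNReal.mul_top (by simpa using hc)]
      exact le_top
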